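/- Define ψ : [0,∞) → ℝ by ψ(t) = Σ_{v=1}^{∞} 4t/(4π²v² + t²)². Then for every real x > 0, the remainder σ(x) = 12x · ln( Γ(x+1) / (√(2πx) · (x/e)^x) ) satisfies σ(x) = 1 − 12 · ∫₀^∞ ψ(t)·e^{−xt} dt; equivalently θ(x) := 1 − σ(x) = 12 · ∫₀^∞ ψ(t)·e^{−xt} dt. -/

import Mathlib

open Real MeasureTheory

/-- The Stirling remainder `σ(x) = 12x · ln( Γ(x+1) / (√(2πx)·(x/e)^x) )`. -/
noncomputable def stirlingSigma (x : ℝ) : ℝ :=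
  12 * x * Real.log (Real.Gamma (x + 1) / (Real.sqrt (2 * π * x) * (x / Real.exp 1) ^ x))

/-- `ψ(t) = Σ_{v=1}^∞ 4t/(4π²v² + t²)²`. -/
noncomputable def stirlingPsi (t : ℝ) : ℝ :=
  ∑' v : ℕ+, 4 * t / (4 * π ^ 2 * (v : ℝ) ^ 2 + t ^ 2) ^ 2


noncomputable def phiS (t : ℝ) : ℝ := ∑' v : ℕ+, 2 / (4 * π ^ 2 * (v : ℝ) ^ 2 + t ^ 2)

lemma a_pos (v : ℕ+) : 0 < 4 * π ^ 2 * (v : ℝ) ^ 2 := by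
  have : (0:ℝ) < v := by exact_mod_cast v.pos
  positivity

lemma a_one (v : ℕ+) : 1 ≤ 4 * π ^ 2 * (v : ℝ) ^ 2 := by
  have h : (1:ℝ) ≤ v := by exact_mod_cast v.pos
  have := Real.pi_gt_three
  have h2 : (1:ℝ) ≤ (v:ℝ)^2 := by nlinarith
  have h3 : (1:ℝ) ≤ 4 * π^2 := by nlinarith
  nlinarith

lemma hasSum_u : HasSum (fun v : ℕ+ => 2 / (4 * π ^ 2 * (v : ℝ) ^ 2)) (1/12) := by
  have h := hasSum_zeta_two
  have h1 : HasSum (fun v : ℕ+ => 1 / ((v : ℕ) : ℝ) ^ 2) (π^2/6) := by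
    have := (hasSum_nat_add_iff' (f := fun n : ℕ => 1 / (n : ℝ) ^ 2) 1).mpr h
    rw [← Equiv.pnatEquivNat.symm.hasSum_iff]
    simpa [Function.comp_def] using this
  have h2 := h1.mul_left (2 / (4 * π^2))
  have e : 2 / (4 * π^2) * (π^2/6) = 1/12 := by
    have := Real.pi_ne_zero
    field_simp; norm_num
  rw [e] at h2
  have e3 : (fun v : ℕ+ => 2 / (4 * π ^ 2 * (v : ℝ) ^ 2)) =
      fun v : ℕ+ => 2 / (4 * π^2) * (1 / ((v : ℕ) : ℝ) ^ 2) := by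
    funext v
    simp only [div_eq_mul_inv, mul_inv]
    ring
  rw [e3]
  exact h2

lemma term_bound (v : ℕ+) (t : ℝ) : ‖4 * t / (4 * π ^ 2 * (v : ℝ) ^ 2 + t ^ 2) ^ 2‖ ≤
    2 / (4 * π ^ 2 * (v : ℝ) ^ 2) := by
  have ha := a_pos v
  have h1 := a_one v
  generalize 4 * π ^ 2 * (v : ℝ) ^ 2 = a at *
  have hp : 0 < a + t^2 := by positivity
  rw [norm_div, norm_mul, Real.norm_eq_abs, Real.norm_eq_abs, Real.norm_eq_abs,
    abs_of_pos (by norm_num : (0:ℝ) < 4), abs_of_pos (by positivity : 0 < (a + t^2)^2),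
    div_le_div_iff₀ (by positivity) ha]
  have hs : t^2 = |t|^2 := (sq_abs t).symm
  rw [hs]
  have := abs_nonneg t
  generalize |t| = s at *
  have h2 : 2 * s ≤ a + s^2 := by nlinarith [sq_nonneg (s-1)]
  have h3 : a ≤ a + s^2 := by nlinarith
  nlinarith [mul_le_mul h2 h3 ha.le (by positivity)]

lemma phi_term_bound (v : ℕ+) (t : ℝ) : ‖2 / (4 * π ^ 2 * (v : ℝ) ^ 2 + t ^ 2)‖ ≤
    2 / (4 * π ^ 2 * (v : ℝ) ^ 2) := by
  have ha := a_pos v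
  rw [Real.norm_eq_abs, abs_of_nonneg (by positivity)]
  gcongr
  nlinarith [sq_nonneg t]

lemma phi_zero : phiS 0 = 1/12 := by
  rw [← hasSum_u.tsum_eq]; simp [phiS]

lemma phi_bound (t : ℝ) : ‖phiS t‖ ≤ 1/12 :=
  tsum_of_norm_bounded hasSum_u (fun v => phi_term_bound v t)

lemma psi_bound (t : ℝ) : ‖stirlingPsi t‖ ≤ 1/12 :=
  tsum_of_norm_bounded hasSum_u (fun v => term_bound v t)

lemma phi_deriv (t : ℝ) : HasDerivAt phiS (- stirlingPsi t) t := by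
  have := hasDerivAt_tsum (𝕜 := ℝ) (g := fun (v : ℕ+) (t : ℝ) => 2 / (4 * π ^ 2 * (v : ℝ) ^ 2 + t ^ 2))
    (g' := fun (v : ℕ+) (t : ℝ) => - (4 * t / (4 * π ^ 2 * (v : ℝ) ^ 2 + t ^ 2) ^ 2))
    (y₀ := 0) hasSum_u.summable ?_ ?_ ?_ t
  · rw [tsum_neg] at this
    exact this
  · intro v y
    have ha := a_pos v
    have h := ((hasDerivAt_pow 2 y).const_add (4 * π ^ 2 * (v : ℝ) ^ 2))
    have h2 := (hasDerivAt_const y (2:ℝ)).div h (by positivity)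
    refine h2.congr_deriv ?_
    simp; ring
  · intro v y
    rw [norm_neg]; exact term_bound v y
  · simpa using hasSum_u.summable

lemma phi_cont : Continuous phiS :=
  continuous_iff_continuousAt.mpr fun t => (phi_deriv t).continuousAt

lemma psi_cont : Continuous stirlingPsi := by
  refine continuous_tsum ?_ hasSum_u.summable term_bound
  intro v
  have ha := a_pos v
  refine Continuous.div (by fun_prop) (by fun_prop) (fun t => by positivity)

lemma integ_bdd {f : ℝ → ℝ} (hf : Continuous f) {C : ℝ} (hb : ∀ t, ‖f t‖ ≤ C) {x : ℝ} (hx : 0 < x) :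
    IntegrableOn (fun t => f t * Real.exp (-x * t)) (Set.Ioi 0) := by
  refine Integrable.bdd_mul (exp_neg_integrableOn_Ioi 0 hx) hf.aestronglyMeasurable
    (Filter.Eventually.of_forall hb)

lemma parts {x : ℝ} (hx : 0 < x) :
    x * ∫ t in Set.Ioi (0:ℝ), phiS t * Real.exp (-x * t) =
      1/12 - ∫ t in Set.Ioi (0 : ℝ), stirlingPsi t * Real.exp (-x * t) := by
  have h := integral_Ioi_mul_deriv_eq_deriv_mul (a := 0) (a' := 1/12) (b' := 0)
    (u := phiS) (u' := fun t => - stirlingPsi t)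
    (v := fun t => Real.exp (-x * t)) (v' := fun t => Real.exp (-x * t) * (-x))
    (fun t _ => phi_deriv t) (fun t _ => by
      simpa using ((hasDerivAt_id t).const_mul (-x)).exp) ?_ ?_ ?_ ?_
  · have e1 : ∀ t, phiS t * (Real.exp (-x * t) * (-x)) = (-x) * (phiS t * Real.exp (-x * t)) :=
      fun t => by ring
    simp only [e1, neg_mul (stirlingPsi _)] at h
    rw [integral_const_mul, integral_neg] at h
    linarith
  · have := (integ_bdd phi_cont phi_bound hx).mul_const (-x)
    refine this.congr (Filter.Eventually.of_forall fun t => ?_)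
    simp; ring
  · have := (integ_bdd psi_cont psi_bound hx).neg
    refine this.congr (Filter.Eventually.of_forall fun t => ?_)
    simp
  · have : Continuous (phiS * fun t => Real.exp (-x * t)) := phi_cont.mul (by fun_prop)
    have h2 := this.tendsto 0
    simp only [Pi.mul_apply, phi_zero] at h2
    simpa using h2.mono_left nhdsWithin_le_nhds
  · have h0 : Filter.Tendsto (fun t : ℝ => Real.exp (-x * t)) Filter.atTop (nhds 0) := by
      refine Real.tendsto_exp_atBot.comp ?_
      exact Filter.tendsto_id.const_mul_atTop_of_neg (by linarith)
    exact bdd_le_mul_tendsto_zero' (1/12) (Filter.Eventually.of_forall phi_bound) h0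

lemma phi_closed {t : ℝ} (ht : 0 < t) :
    phiS t * (1 - Real.exp (-t)) = (Real.exp (-t) / 2 + 1/2) / t - (1 - Real.exp (-t)) / t^2 := by
  have hpi := Real.pi_pos
  have hpc : (π : ℂ) ≠ 0 := by exact_mod_cast hpi.ne'
  have htc : (t : ℂ) ≠ 0 := by exact_mod_cast ht.ne'
  set x : ℂ := Complex.I * t / (2 * π) with hx
  have him : x.im = t / (2*π) := by
    have : x = ((t / (2*π) : ℝ) : ℂ) * Complex.I := by rw [hx]; push_cast; ring
    rw [this, Complex.im_ofReal_mul, Complex.I_im, mul_one]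
  have hz : x ∈ Complex.integerComplement := by
    rintro ⟨n, hn⟩
    have := congrArg Complex.im hn
    rw [him] at this
    simp at this
    have h2 : 0 < t / (2*π) := by positivity
    simp_all
  have h := cot_series_rep hz
  have e2 : ∀ n : ℕ+, 1 / (x - n) + 1 / (x + n) =
      (-(2 * π * t) * Complex.I) * ((2 / (4 * π ^ 2 * (n : ℝ) ^ 2 + t ^ 2) : ℝ) : ℂ) := by
    intro n
    have ha := a_pos n
    have hne : (4 * (π:ℂ) ^ 2 * (n : ℂ) ^ 2 + (t:ℂ) ^ 2) ≠ 0 := by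
      have : 4 * π ^ 2 * (n : ℝ) ^ 2 + t ^ 2 ≠ 0 := by positivity
      exact_mod_cast this
    have hne1 : x - n ≠ 0 := by
      intro h
      have := congrArg Complex.im h
      simp [him, ht.ne'] at this
    have hne2 : x + n ≠ 0 := by
      intro h
      have := congrArg Complex.im h
      simp [him, ht.ne'] at this
    have e : (x - n) * (x + n) = -(4 * (π:ℂ) ^ 2 * (n : ℂ) ^ 2 + (t:ℂ) ^ 2) / (4 * π^2) := by
      rw [hx]; field_simp; ring_nf; simp [Complex.I_sq]
    have : 1 / (x - n) + 1 / (x + n) = 2 * x / ((x-n) * (x+n)) := by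
      field_simp; ring
    rw [this, e, hx]
    push_cast
    field_simp
    norm_num
  simp_rw [e2] at h
  rw [tsum_mul_left, ← Complex.ofReal_tsum] at h
  change _ = _ + _ * ((phiS t : ℝ) : ℂ) at h
  have hE : Complex.exp (2 * Complex.I * (π * x)) = ((Real.exp (-t) : ℝ) : ℂ) := by
    push_cast; congr 1; rw [hx]; field_simp; simp
  rw [Complex.cot_eq_exp_ratio, hE] at h
  have hlt : Real.exp (-t) < 1 := by simpa using ht
  have hc : (1 - (Real.exp (-t) : ℝ) : ℂ) ≠ 0 := by
    have : 1 - Real.exp (-t) ≠ 0 := by linarith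
    exact_mod_cast this
  generalize Real.exp (-t) = E at *
  generalize phiS t = p at *
  have key : (p : ℂ) * (1 - E) = (E / 2 + 1/2) / t - (1 - E) / t^2 := by
    rw [hx] at h
    field_simp at h ⊢
    have hI := Complex.I_sq
    rw [hI] at h
    linear_combination -h
  have h3 : ((p * (1 - E) : ℝ) : ℂ) = (((E / 2 + 1/2) / t - (1 - E) / t^2 : ℝ) : ℂ) := by
    push_cast at key ⊢
    exact key
  exact Complex.ofReal_injective h3

noncomputable def lapF (x : ℝ) : ℝ := ∫ t in Set.Ioi (0:ℝ), phiS t * Real.exp (-x * t)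

lemma inner_int {t : ℝ} (ht : 0 < t) (x : ℝ) :
    ∫ u in (0:ℝ)..1, (1/2 - u) * Real.exp (-(x+u) * t) =
      phiS t * (1 - Real.exp (-t)) * Real.exp (-x * t) := by
  rw [phi_closed ht]
  have hd : ∀ u ∈ Set.uIcc (0:ℝ) 1, HasDerivAt
      (fun u => (-(1/2 - u) / t + 1 / t^2) * Real.exp (-(x+u) * t))
      ((1/2 - u) * Real.exp (-(x+u) * t)) u := by
    intro u _
    have h1 : HasDerivAt (fun u : ℝ => -(1/2 - u) / t + 1 / t^2) (1/t) u := by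
      have := ((((hasDerivAt_id u).const_sub (1/2)).neg).div_const t).add_const (1/t^2)
      simpa using this
    have h2 : HasDerivAt (fun u : ℝ => -(x+u)*t) (-t) u := by
      have := (((hasDerivAt_id u).const_add x).neg).mul_const t
      simpa using this
    refine (h1.mul h2.exp).congr_deriv ?_
    field_simp
    ring
  rw [intervalIntegral.integral_eq_sub_of_hasDerivAt hd
    (Continuous.intervalIntegrable (by fun_prop) _ _)]
  have e1 : Real.exp (-(x+1)*t) = Real.exp (-t) * Real.exp (-x*t) := by
    rw [← Real.exp_add]; congr 1; ring
  rw [e1]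
  simp only [add_zero]
  field_simp
  ring

lemma outer_int {x : ℝ} (hx : 0 < x) :
    ∫ u in (0:ℝ)..1, ∫ t in Set.Ioi (0:ℝ), (1/2 - u) * Real.exp (-(x+u) * t) =
      (x + 1/2) * (Real.log (x+1) - Real.log x) - 1 := by
  have e : ∀ u ∈ Set.uIcc (0:ℝ) 1, ∫ t in Set.Ioi (0:ℝ), (1/2 - u) * Real.exp (-(x+u) * t) =
      (1/2 - u) / (x + u) := by
    intro u hu
    rw [Set.uIcc_of_le zero_le_one] at hu
    have hp : 0 < x + u := by linarith [hu.1]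
    rw [integral_const_mul, integral_exp_mul_Ioi (by linarith)]
    simp only [mul_zero, Real.exp_zero]
    rw [neg_div_neg_eq, mul_one_div]
  rw [intervalIntegral.integral_congr e]
  have hd : ∀ u ∈ Set.uIcc (0:ℝ) 1, HasDerivAt
      (fun u => (x + 1/2) * Real.log (x + u) - u) ((1/2 - u) / (x + u)) u := by
    intro u hu
    rw [Set.uIcc_of_le zero_le_one] at hu
    have hp : 0 < x + u := by linarith [hu.1]
    have h := ((((hasDerivAt_id u).const_add x).log hp.ne').const_mul (x + 1/2)).sub (hasDerivAt_id u)
    refine h.congr_deriv ?_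
    simp only [id]
    field_simp
    ring
  rw [intervalIntegral.integral_eq_sub_of_hasDerivAt hd]
  · simp; ring
  · apply ContinuousOn.intervalIntegrable
    refine ContinuousOn.div (by fun_prop) (by fun_prop) ?_
    intro u hu
    rw [Set.uIcc_of_le zero_le_one] at hu
    linarith [hu.1]

lemma lapF_sub {x : ℝ} (hx : 0 < x) :
    lapF x - lapF (x+1) = (x + 1/2) * (Real.log (x+1) - Real.log x) - 1 := by
  rw [← outer_int hx, intervalIntegral_integral_swap, lapF, lapF, ← integral_sub
    (integ_bdd phi_cont phi_bound hx) (integ_bdd phi_cont phi_bound (by linarith))]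
  · refine setIntegral_congr_fun measurableSet_Ioi fun t ht => ?_
    rw [inner_int ht]
    have e1 : Real.exp (-(x+1)*t) = Real.exp (-t) * Real.exp (-x*t) := by
      rw [← Real.exp_add]; congr 1; ring
    rw [e1]; ring
  · rw [Set.uIoc_of_le zero_le_one]
    have h1 : Integrable (fun _ : ℝ => (1:ℝ)) (volume.restrict (Set.Ioc (0:ℝ) 1)) :=
      integrable_const _
    have h2 := h1.mul_prod (exp_neg_integrableOn_Ioi 0 hx)
    refine h2.mono' (Continuous.aestronglyMeasurable (by unfold Function.uncurry; fun_prop)) ?_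
    rw [Measure.prod_restrict]
    refine (ae_restrict_iff' (measurableSet_Ioc.prod measurableSet_Ioi)).mpr
      (Filter.Eventually.of_forall ?_)
    rintro ⟨u, t⟩ ⟨hu, ht⟩
    simp only [Set.mem_Ioc, Set.mem_Ioi] at hu ht
    simp only [Function.uncurry, norm_mul, Real.norm_eq_abs, Real.abs_exp]
    refine mul_le_mul (abs_le.mpr ⟨by linarith, by linarith⟩) (Real.exp_le_exp.mpr ?_)
      (Real.exp_nonneg _) zero_le_one
    nlinarith

lemma lapF_bound {x : ℝ} (hx : 0 < x) : ‖lapF x‖ ≤ (1/12) * (1/x) := by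
  have h : ‖lapF x‖ ≤ ∫ t in Set.Ioi (0:ℝ), (1/12) * Real.exp (-x * t) := by
    refine norm_integral_le_of_norm_le ((exp_neg_integrableOn_Ioi 0 hx).const_mul _)
      (Filter.Eventually.of_forall fun t => ?_)
    rw [norm_mul, Real.norm_eq_abs (Real.exp _), Real.abs_exp]
    exact mul_le_mul_of_nonneg_right (phi_bound t) (Real.exp_nonneg _)
  rw [integral_const_mul, integral_exp_mul_Ioi (by linarith)] at h
  simpa using h

open Filter Topology in
lemma lapF_tendsto {x : ℝ} (hx : 0 < x) : Tendsto (fun n : ℕ => lapF (x + n)) atTop (𝓝 0) := by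
  refine squeeze_zero_norm (a := fun n : ℕ => (1/12) * (1/(x + n)))
    (fun n => lapF_bound (by positivity)) ?_
  have h1 : Tendsto (fun n : ℕ => x + (n:ℝ)) atTop atTop :=
    tendsto_atTop_add_const_left _ _ tendsto_natCast_atTop_atTop
  have h2 := h1.inv_tendsto_atTop.const_mul (1/12)
  simp only [mul_zero] at h2
  simpa only [one_div (x + _), Pi.inv_apply] using h2

/-- The log remainder in Stirling's formula. -/
noncomputable def muS (y : ℝ) : ℝ :=
  Real.log (Real.Gamma (y + 1)) - (y + 1/2) * Real.log y + y - Real.log (2 * π) / 2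

lemma sigma_eq {x : ℝ} (hx : 0 < x) : stirlingSigma x = 12 * x * muS x := by
  have hg := Real.Gamma_pos_of_pos (by linarith : 0 < x + 1)
  have hpi := Real.pi_pos
  have hq : 0 < (x / Real.exp 1) ^ x := by positivity
  have hs : 0 < Real.sqrt (2 * π * x) := by positivity
  rw [stirlingSigma, muS, Real.log_div hg.ne' (by positivity), Real.log_mul hs.ne' hq.ne',
    Real.log_sqrt (by positivity), Real.log_rpow (by positivity), Real.log_div hx.ne' (by positivity),
    Real.log_exp, Real.log_mul (by positivity) hx.ne']
  ring

lemma muS_sub {x : ℝ} (hx : 0 < x) :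
    muS x - muS (x+1) = (x + 1/2) * (Real.log (x+1) - Real.log x) - 1 := by
  have hg := Real.Gamma_pos_of_pos (by linarith : 0 < x + 1)
  rw [muS, muS, Real.Gamma_add_one (by linarith : x + 1 ≠ 0), Real.log_mul (by linarith) hg.ne']
  ring

open Filter Topology in
lemma stirling_log : Tendsto (fun n : ℕ => Real.log (n.factorial) - (n + 1/2) * Real.log n + n) atTop
    (𝓝 (Real.log (2 * π) / 2)) := by
  have hpi := Real.pi_pos
  have h := (Real.continuousAt_log (by positivity : Real.sqrt π ≠ 0)).tendsto.comp
    Stirling.tendsto_stirlingSeq_sqrt_pi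
  have h2 := h.add_const (Real.log 2 / 2)
  have e : Real.log (Real.sqrt π) + Real.log 2 / 2 = Real.log (2 * π) / 2 := by
    rw [Real.log_sqrt hpi.le, Real.log_mul (by norm_num) hpi.ne']; ring
  rw [e] at h2
  refine h2.congr' ?_
  filter_upwards [eventually_gt_atTop 0] with n hn
  have hn' : (0:ℝ) < n := by exact_mod_cast hn
  have hf : (0:ℝ) < n.factorial := by exact_mod_cast n.factorial_pos
  simp only [Function.comp, Stirling.stirlingSeq]
  rw [Real.log_div hf.ne' (by positivity), Real.log_mul (by positivity) (by positivity),
    Real.log_sqrt (by positivity), Real.log_pow, Real.log_div hn'.ne' (by positivity), Real.log_exp,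
    Real.log_mul (by norm_num) hn'.ne']
  ring

open Filter Topology in
lemma muS_tendsto {x : ℝ} (hx : 0 < x) : Tendsto (fun n : ℕ => muS (x + n)) atTop (𝓝 0) := by
  have hfeq : ∀ {y : ℝ}, 0 < y → (Real.log ∘ Real.Gamma) (y + 1) =
      (Real.log ∘ Real.Gamma) y + Real.log y := by
    intro y hy
    simp only [Function.comp]
    rw [Real.Gamma_add_one hy.ne', Real.log_mul hy.ne' (Real.Gamma_pos_of_pos hy).ne', add_comm]
  have hG := Real.BohrMollerup.tendsto_logGammaSeq Real.convexOn_log_Gamma hfeq hx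
  have hL := Real.tendsto_mul_log_one_add_div_atTop x
  have hL' : Tendsto (fun n : ℕ => (n:ℝ) * Real.log (1 + x / n)) atTop (𝓝 x) :=
    hL.comp tendsto_natCast_atTop_atTop
  have hinv : Tendsto (fun n : ℕ => ((n:ℝ))⁻¹) atTop (𝓝 0) := tendsto_inv_atTop_nhds_zero_nat
  have hL0 := hL'.mul hinv
  have hall := (((hG.const_sub (Real.log (Real.Gamma x))).add stirling_log).sub hL').sub
    (hL0.const_mul (x + 1/2)) |>.add_const (x - Real.log (2 * π) / 2)
  have e : Real.log (Real.Gamma x) - ((Real.log ∘ Real.Gamma) x - (Real.log ∘ Real.Gamma) 1) +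
    Real.log (2 * π) / 2 - x - (x + 1/2) * (x * 0) + (x - Real.log (2 * π) / 2) = 0 := by
    simp
  rw [e] at hall
  refine hall.congr' ?_
  filter_upwards [eventually_gt_atTop 0] with n hn
  have hn' : (0:ℝ) < n := by exact_mod_cast hn
  have hsum := Real.BohrMollerup.f_add_nat_eq hfeq hx (n+1)
  have e1 : Real.log (x + n) = Real.log n + Real.log (1 + x / n) := by
    rw [← Real.log_mul hn'.ne' (by positivity)]
    congr 1; field_simp; ring
  simp only [Function.comp] at hsum
  push_cast at hsum
  rw [muS, add_assoc x, hsum, e1, Real.BohrMollerup.logGammaSeq]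
  field_simp
  ring

open Filter Topology in
lemma muS_eq {x : ℝ} (hx : 0 < x) : muS x = lapF x := by
  have hc : ∀ n : ℕ, muS (x + n) - lapF (x + n) = muS x - lapF x := by
    intro n
    induction n with
    | zero => simp
    | succ k ih =>
      have hp : 0 < x + (k:ℝ) := by positivity
      have h1 := muS_sub hp
      have h2 := lapF_sub hp
      push_cast
      rw [← add_assoc]
      linarith
  have h := (muS_tendsto hx).sub (lapF_tendsto hx)
  simp only [hc, sub_zero] at h
  have := tendsto_nhds_unique h tendsto_const_nhds
  linarith

/-- For `x > 0`, `σ(x) = 1 − 12 · ∫₀^∞ ψ(t)·e^{−xt} dt`; equivalently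
`θ(x) = 1 − σ(x) = 12 · ∫₀^∞ ψ(t)·e^{−xt} dt`. -/
theorem stirlingSigma_eq_one_sub_integral :
    ∀ x : ℝ, 0 < x →
      stirlingSigma x = 1 - 12 * ∫ t in Set.Ioi (0 : ℝ), stirlingPsi t * Real.exp (-x * t) := by
  intro x hx
  have h := parts hx
  rw [sigma_eq hx, muS_eq hx, lapF, mul_assoc, h]
  ring
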